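/- If a two-dimensional complex Finsler metric on D is weakly Kähler and B = 0 on D, then it is a complex Landsberg metric. -/

import Mathlib

open Complex

noncomputable section

namespace CFinsler

/-- A point of `T'M` in local coordinates: `(z, η) ∈ ℂⁿ × ℂⁿ`. -/
abbrev Pt (n : ℕ) := (Fin n → ℂ) × (Fin n → ℂ)

variable {n : ℕ}

/-- Wirtinger derivative `∂f/∂z^k`. -/
def dz (f : Pt n → ℂ) (k : Fin n) (p : Pt n) : ℂ :=
  (1 / 2) * (fderiv ℝ f p ((Pi.single k 1 : Fin n → ℂ), 0) -
    Complex.I * fderiv ℝ f p ((Pi.single k Complex.I : Fin n → ℂ), 0))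

/-- Wirtinger derivative `∂f/∂z̄^k`. -/
def dzbar (f : Pt n → ℂ) (k : Fin n) (p : Pt n) : ℂ :=
  (1 / 2) * (fderiv ℝ f p ((Pi.single k 1 : Fin n → ℂ), 0) +
    Complex.I * fderiv ℝ f p ((Pi.single k Complex.I : Fin n → ℂ), 0))

/-- Wirtinger derivative `∂f/∂η^k`. -/
def de (f : Pt n → ℂ) (k : Fin n) (p : Pt n) : ℂ :=
  (1 / 2) * (fderiv ℝ f p (0, (Pi.single k 1 : Fin n → ℂ)) -
    Complex.I * fderiv ℝ f p (0, (Pi.single k Complex.I : Fin n → ℂ)))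

/-- Wirtinger derivative `∂f/∂η̄^k`. -/
def debar (f : Pt n → ℂ) (k : Fin n) (p : Pt n) : ℂ :=
  (1 / 2) * (fderiv ℝ f p (0, (Pi.single k 1 : Fin n → ℂ)) +
    Complex.I * fderiv ℝ f p (0, (Pi.single k Complex.I : Fin n → ℂ)))

/-- The fundamental metric tensor `g_{i j̄} := ∂²L/∂η^i ∂η̄^j`. -/
def gm (L : Pt n → ℂ) (i j : Fin n) : Pt n → ℂ := de (debar L j) i

/-- `L` is an `n`-dimensional complex Finsler metric on `D`. -/
structure IsCFM (n : ℕ) (D : Set (Pt n)) (L : Pt n → ℂ) : Prop where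
  openD : IsOpen D
  fiber_ne : ∀ p ∈ D, p.2 ≠ 0
  conic : ∀ p ∈ D, ∀ lam : ℂ, lam ≠ 0 → (p.1, lam • p.2) ∈ D
  smooth : ContDiffOn ℝ (⊤ : ℕ∞) L D
  real_im : ∀ p ∈ D, (L p).im = 0
  pos : ∀ p ∈ D, 0 < (L p).re
  homog : ∀ p ∈ D, ∀ lam : ℂ, lam ≠ 0 →
    L (p.1, lam • p.2) = ((Complex.normSq lam : ℝ) : ℂ) * L p
  hermitian : ∀ p ∈ D, ∀ i j, (starRingEnd ℂ) (gm L i j p) = gm L j i p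
  posdef : ∀ p ∈ D, ∀ v : Fin n → ℂ, v ≠ 0 →
    0 < (∑ i, ∑ j, gm L i j p * v i * (starRingEnd ℂ) (v j)).re

variable (L : Pt n → ℂ)

/-- The metric tensor as a matrix at a point. -/
def gmat (p : Pt n) : Matrix (Fin n) (Fin n) ℂ := fun i j => gm L i j p

/-- The inverse metric tensor `g^{l̄ i}`. -/
def gi (l i : Fin n) (p : Pt n) : ℂ := (gmat L p)⁻¹ l i

/-- The Chern–Finsler nonlinear connection coefficients
`N^i_k := g^{m̄ i} (∂g_{l m̄}/∂z^k) η^l`. -/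
def Nc (i k : Fin n) (p : Pt n) : ℂ :=
  ∑ m, ∑ l, gi L m i p * dz (gm L l m) k p * p.2 l

/-- The horizontal derivation `δ_k := ∂/∂z^k − N^j_k ∂/∂η^j`. -/
def del (f : Pt n → ℂ) (k : Fin n) (p : Pt n) : ℂ :=
  dz f k p - ∑ j, Nc L j k p * de f j p

/-- The conjugate horizontal derivation `δ_k̄ := ∂/∂z̄^k − N̄^j_k ∂/∂η̄^j`. -/
def delbar (f : Pt n → ℂ) (k : Fin n) (p : Pt n) : ℂ :=
  dzbar f k p - ∑ j, (starRingEnd ℂ) (Nc L j k p) * debar f j p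

/-- The horizontal Chern–Finsler connection coefficients `L^i_{jk} := g^{l̄ i} δ_k(g_{j l̄})`. -/
def Lc (i j k : Fin n) (p : Pt n) : ℂ := ∑ l, gi L l i p * del L (gm L j l) k p

/-- The vertical Chern–Finsler connection coefficients `C^i_{jk} := g^{l̄ i} ∂g_{j l̄}/∂η^k`. -/
def Cc (i j k : Fin n) (p : Pt n) : ℂ := ∑ l, gi L l i p * de (gm L j l) k p

/-- The spray coefficients `G^i := ½ N^i_j η^j`. -/
def Gs (i : Fin n) (p : Pt n) : ℂ := (1 / 2) * ∑ j, Nc L i j p * p.2 j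

/-- The canonical horizontal derivation `δ̊_k := ∂/∂z^k − (∂G^j/∂η^k) ∂/∂η^j`. -/
def delc (f : Pt n → ℂ) (k : Fin n) (p : Pt n) : ℂ :=
  dz f k p - ∑ j, de (Gs L j) k p * de f j p

/-- `F := √L`. -/
def Fh (p : Pt n) : ℂ := (Real.sqrt ((L p).re) : ℂ)

/-- `l^i := η^i / F`. -/
def lup (i : Fin n) (p : Pt n) : ℂ := p.2 i / Fh L p

/-- `l_i := g_{i j̄} η̄^j / F`. -/
def llow (i : Fin n) (p : Pt n) : ℂ :=
  (∑ j, gm L i j p * (starRingEnd ℂ) (p.2 j)) / Fh L p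

/-- `√g` where `g := det(g_{i j̄})`. -/
def sg (p : Pt n) : ℂ := (Real.sqrt ((gmat L p).det.re) : ℂ)

/-- The metric is Kähler. -/
def IsKahler (D : Set (Pt n)) : Prop := ∀ p ∈ D, ∀ i j k, Lc L i j k p = Lc L i k j p

/-- The metric is weakly Kähler. -/
def IsWeaklyKahler (D : Set (Pt n)) : Prop :=
  ∀ p ∈ D, ∀ k, (∑ i, ∑ j, ∑ l, gm L i l p * (Lc L i j k p - Lc L i k j p) *
    p.2 j * (starRingEnd ℂ) (p.2 l)) = 0

/-- The metric is purely Hermitian: `g_{i j̄}` does not depend on the fibre variable. -/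
def IsPurelyHermitian (D : Set (Pt n)) : Prop :=
  ∀ p ∈ D, ∀ i j k, de (gm L i j) k p = 0 ∧ debar (gm L i j) k p = 0

/-- The metric is a complex Berwald metric: Kähler with `L^i_{jk}` independent of the
fibre variable. -/
def IsBerwald (D : Set (Pt n)) : Prop :=
  IsKahler L D ∧ ∀ p ∈ D, ∀ i j k l, de (Lc L i j k) l p = 0 ∧ debar (Lc L i j k) l p = 0

/-- The metric is a complex Landsberg metric: the Berwald and Rund connections coincide. -/
def IsLandsberg (D : Set (Pt n)) : Prop :=
  ∀ p ∈ D, ∀ i j k, de (de (Gs L i) k) j p =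
    (1 / 2) * ∑ l, gi L l i p * (delc L (gm L j l) k p + delc L (gm L k l) j p)

/-- `m^i` of the local complex Berwald frame: `m¹ = −l₂/√g`, `m² = l₁/√g`. -/
def mup (L : Pt 2 → ℂ) (i : Fin 2) (p : Pt 2) : ℂ :=
  if i = 0 then -(llow L 1 p) / sg L p else llow L 0 p / sg L p

/-- `m_i := g_{i j̄} m̄^j`. -/
def mlow (L : Pt 2 → ℂ) (i : Fin 2) (p : Pt 2) : ℂ :=
  ∑ j, gm L i j p * (starRingEnd ℂ) (mup L j p)

/-- `A := m^j m^k l_h C^h_{kj}`. -/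
def sA (L : Pt 2 → ℂ) (p : Pt 2) : ℂ :=
  ∑ j, ∑ k, ∑ h, mup L j p * mup L k p * llow L h p * Cc L h k j p

/-- `B := m_h m^k m^j C^h_{jk}`. -/
def sB (L : Pt 2 → ℂ) (p : Pt 2) : ℂ :=
  ∑ j, ∑ k, ∑ h, mlow L h p * mup L k p * mup L j p * Cc L h j k p

/-- `J := l^j l^k l_i L^i_{jk}`. -/
def sJ (L : Pt 2 → ℂ) (p : Pt 2) : ℂ :=
  ∑ j, ∑ k, ∑ i, lup L j p * lup L k p * llow L i p * Lc L i j k p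

/-- `U := m^j l^k l_i L^i_{jk}`. -/
def sU (L : Pt 2 → ℂ) (p : Pt 2) : ℂ :=
  ∑ j, ∑ k, ∑ i, mup L j p * lup L k p * llow L i p * Lc L i j k p

/-- `V := l^j m^k l_i L^i_{jk}`. -/
def sV (L : Pt 2 → ℂ) (p : Pt 2) : ℂ :=
  ∑ j, ∑ k, ∑ i, lup L j p * mup L k p * llow L i p * Lc L i j k p

/-- `X := m^j m^k l_i L^i_{jk}`. -/
def sX (L : Pt 2 → ℂ) (p : Pt 2) : ℂ :=
  ∑ j, ∑ k, ∑ i, mup L j p * mup L k p * llow L i p * Lc L i j k p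

/-- `O := l^j l^k m_i L^i_{jk}`. -/
def sO (L : Pt 2 → ℂ) (p : Pt 2) : ℂ :=
  ∑ j, ∑ k, ∑ i, lup L j p * lup L k p * mlow L i p * Lc L i j k p

/-- `Y := m^j l^k m_i L^i_{jk}`. -/
def sY (L : Pt 2 → ℂ) (p : Pt 2) : ℂ :=
  ∑ j, ∑ k, ∑ i, mup L j p * lup L k p * mlow L i p * Lc L i j k p

/-- `E := l^j m^k m_i L^i_{jk}`. -/
def sE (L : Pt 2 → ℂ) (p : Pt 2) : ℂ :=
  ∑ j, ∑ k, ∑ i, lup L j p * mup L k p * mlow L i p * Lc L i j k p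

/-- `H := m^j m^k m_i L^i_{jk}`. -/
def sH (L : Pt 2 → ℂ) (p : Pt 2) : ℂ :=
  ∑ j, ∑ k, ∑ i, mup L j p * mup L k p * mlow L i p * Lc L i j k p

/-- The vertical curvature invariant `I := −(∂B/∂η̄^s) m̄^s − B B̄/2`. -/
def vI (L : Pt 2 → ℂ) (p : Pt 2) : ℂ :=
  -(∑ s, debar (sB L) s p * (starRingEnd ℂ) (mup L s p)) -
    sB L p * (starRingEnd ℂ) (sB L p) / 2

/-- The `v v̄`-Riemann type tensor `S_{r̄ j h̄ k} := −g_{i r̄} ∂C^i_{jk}/∂η̄^h`. -/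
def Sv (L : Pt 2 → ℂ) (r j h k : Fin 2) (p : Pt 2) : ℂ :=
  -∑ i, gm L i r p * debar (Cc L i j k) h p

/-- The `h h̄`-Riemann type tensor
`R_{r̄ j h̄ k} := g_{i r̄} (−δ_h̄(L^i_{jk}) − δ_h̄(N^l_k) C^i_{jl})`. -/
def Rh (L : Pt 2 → ℂ) (r j h k : Fin 2) (p : Pt 2) : ℂ :=
  ∑ i, gm L i r p *
    (-(delbar L (Lc L i j k) h p) - ∑ l, delbar L (Nc L l k) h p * Cc L i j l p)

/-- The horizontal curvature invariant `K := −(1/F) δ_k̄(J) η̄^k`. -/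
def hK (L : Pt 2 → ℂ) (p : Pt 2) : ℂ :=
  -(1 / Fh L p) * ∑ k, delbar L (sJ L) k p * (starRingEnd ℂ) (p.2 k)

/-- The horizontal curvature invariant
`W := −δ_s̄(H) m̄^s − ½ H (V̄+H̄) − B F δ_s̄(E) m̄^s`. -/
def hW (L : Pt 2 → ℂ) (p : Pt 2) : ℂ :=
  -(∑ s, delbar L (sH L) s p * (starRingEnd ℂ) (mup L s p)) -
    (1 / 2) * sH L p * ((starRingEnd ℂ) (sV L p) + (starRingEnd ℂ) (sH L p)) -
    sB L p * Fh L p * ∑ s, delbar L (sE L) s p * (starRingEnd ℂ) (mup L s p)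

/-- The weak symmetry condition `R_{0̄ k 0̄ 0} = R_{0̄ 0 0̄ k}`, i.e.
`R_{r̄ k h̄ s} η̄^r η̄^h η^s = R_{r̄ s h̄ k} η̄^r η^s η̄^h`. -/
def WeakSym (L : Pt 2 → ℂ) (D : Set (Pt 2)) : Prop :=
  ∀ p ∈ D, ∀ k,
    (∑ r, ∑ h, ∑ s, Rh L r k h s p * (starRingEnd ℂ) (p.2 r) *
      (starRingEnd ℂ) (p.2 h) * p.2 s) =
    ∑ r, ∑ s, ∑ h, Rh L r s h k p * (starRingEnd ℂ) (p.2 r) * p.2 s *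
      (starRingEnd ℂ) (p.2 h)


section Derivation

variable {E : Type*} [NormedAddCommGroup E] [NormedSpace ℝ E]

/-- The first-order operator `½ (∂_u + c ∂_v)`; all Wirtinger derivatives have this form. -/
def wirtinger (c : ℂ) (u v : E) (f : E → ℂ) (p : E) : ℂ :=
  (1 / 2) * (fderiv ℝ f p u + c * fderiv ℝ f p v)

/-- `d` behaves on smooth functions on `D` as a smooth complex vector field. -/
structure IsDerivationOn (D : Set E) (d : (E → ℂ) → E → ℂ) : Prop where
  smooth : ∀ {f}, ContDiffOn ℝ (⊤ : ℕ∞) f D → ContDiffOn ℝ (⊤ : ℕ∞) (d f) D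
  congr : ∀ {f g}, (∀ q ∈ D, f q = g q) → ∀ p ∈ D, d f p = d g p
  add : ∀ {f g}, ContDiffOn ℝ (⊤ : ℕ∞) f D → ContDiffOn ℝ (⊤ : ℕ∞) g D → ∀ p ∈ D,
    d (fun q => f q + g q) p = d f p + d g p
  mul : ∀ {f g}, ContDiffOn ℝ (⊤ : ℕ∞) f D → ContDiffOn ℝ (⊤ : ℕ∞) g D → ∀ p ∈ D,
    d (fun q => f q * g q) p = d f p * g p + f p * d g p
  const : ∀ (a : ℂ) (p : E), d (fun _ => a) p = 0

variable {D : Set E} {d : (E → ℂ) → E → ℂ}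

theorem isDerivationOn_wirtinger (hD : IsOpen D) (c : ℂ) (u v : E) :
    IsDerivationOn D (wirtinger c u v) where
  smooth {f} hf := by
    have h := hf.fderiv_of_isOpen (m := (⊤ : ℕ∞)) hD (by simp)
    unfold wirtinger
    exact contDiffOn_const.mul ((h.clm_apply contDiffOn_const).add
      (contDiffOn_const.mul (h.clm_apply contDiffOn_const)))
  congr {f g} hfg p hp := by
    have : f =ᶠ[nhds p] g := Filter.eventually_of_mem (hD.mem_nhds hp) hfg
    simp only [wirtinger, this.fderiv_eq]
  add {f g} hf hg p hp := by
    have hf' := (hf.contDiffAt (hD.mem_nhds hp)).differentiableAt (by simp)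
    have hg' := (hg.contDiffAt (hD.mem_nhds hp)).differentiableAt (by simp)
    simp only [wirtinger, fderiv_fun_add hf' hg', add_apply]
    ring
  mul {f g} hf hg p hp := by
    have hf' := (hf.contDiffAt (hD.mem_nhds hp)).differentiableAt (by simp)
    have hg' := (hg.contDiffAt (hD.mem_nhds hp)).differentiableAt (by simp)
    simp only [wirtinger, fderiv_fun_mul hf' hg', add_apply,
      smul_apply, smul_eq_mul]
    ring
  const a p := by simp [wirtinger]

theorem wirtinger_comm (hD : IsOpen D) {f : E → ℂ} (hf : ContDiffOn ℝ (⊤ : ℕ∞) f D)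
    (c c' : ℂ) (u v u' v' : E) {p : E} (hp : p ∈ D) :
    wirtinger c u v (wirtinger c' u' v' f) p = wirtinger c' u' v' (wirtinger c u v f) p := by
  have hs := (hf.contDiffAt (hD.mem_nhds hp)).isSymmSndFDerivAt (by
    simpa using WithTop.coe_le_coe.2 (le_top : (2 : ℕ∞) ≤ ⊤))
  have h := ((hf.fderiv_of_isOpen (m := (⊤ : ℕ∞)) hD (by simp)).contDiffAt
    (hD.mem_nhds hp)).differentiableAt (by simp)
  have key : ∀ (c : ℂ) (u v w : E), fderiv ℝ (wirtinger c u v f) p w =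
      (1 / 2) * (fderiv ℝ (fderiv ℝ f) p w u + c * fderiv ℝ (fderiv ℝ f) p w v) := by
    intro c u v w
    have hu : ∀ x : E, HasFDerivAt (fun q => fderiv ℝ f q x)
        ((fderiv ℝ (fderiv ℝ f) p).flip x) p := fun x => by
      simpa using h.hasFDerivAt.clm_apply (hasFDerivAt_const x p)
    have := (((hu u).add ((hu v).const_mul c)).const_mul (1 / 2 : ℂ)).fderiv
    change fderiv ℝ (fun q => (1 / 2 : ℂ) * (fderiv ℝ f q u + c * fderiv ℝ f q v)) p w = _
    erw [this]
    simp [mul_add]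
  rw [wirtinger, key, key, wirtinger, key, key, hs u' u, hs u' v, hs v' u, hs v' v]
  ring

namespace IsDerivationOn

theorem sum (hd : IsDerivationOn D d) {ι : Type*} (s : Finset ι) {f : ι → E → ℂ}
    (hf : ∀ i, ContDiffOn ℝ (⊤ : ℕ∞) (f i) D) {p : E} (hp : p ∈ D) :
    d (fun q => ∑ i ∈ s, f i q) p = ∑ i ∈ s, d (f i) p := by
  classical
  induction s using Finset.induction_on with
  | empty => simpa using hd.const 0 p
  | insert a s ha ih =>
    simp only [Finset.sum_insert ha]
    rw [hd.add (hf a) (ContDiffOn.sum fun i _ => hf i) p hp, ih]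

theorem sum_mul (hd : IsDerivationOn D d) {ι : Type*} (s : Finset ι) {f g : ι → E → ℂ}
    (hf : ∀ i, ContDiffOn ℝ (⊤ : ℕ∞) (f i) D) (hg : ∀ i, ContDiffOn ℝ (⊤ : ℕ∞) (g i) D)
    {p : E} (hp : p ∈ D) :
    d (fun q => ∑ i ∈ s, f i q * g i q) p =
      ∑ i ∈ s, (d (f i) p * g i p + f i p * d (g i) p) := by
  rw [hd.sum s (f := fun i q => f i q * g i q) (fun i => (hf i).mul (hg i)) hp]
  exact Finset.sum_congr rfl fun i _ => hd.mul (hf i) (hg i) p hp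

/-- An Euler identity `∑ xᵢ eᵢ f = f` is inherited by `d f` when `d` kills the `xᵢ` and commutes
with the `eᵢ`. -/
theorem euler (hd : IsDerivationOn D d) {ι : Type*} [Fintype ι] {x : ι → E → ℂ}
    {e : ι → (E → ℂ) → E → ℂ} {f : E → ℂ} (hx : ∀ i, ContDiffOn ℝ (⊤ : ℕ∞) (x i) D)
    (hdx : ∀ i, ∀ p ∈ D, d (x i) p = 0) (he : ∀ i, ContDiffOn ℝ (⊤ : ℕ∞) (e i f) D)
    (hcomm : ∀ i, ∀ p ∈ D, d (e i f) p = e i (d f) p)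
    (hf : ∀ p ∈ D, ∑ i, x i p * e i f p = f p) :
    ∀ p ∈ D, ∑ i, x i p * e i (d f) p = d f p := by
  intro p hp
  rw [← hd.congr hf p hp, hd.sum_mul _ hx he hp]
  refine Finset.sum_congr rfl fun i _ => ?_
  rw [hdx i p hp, hcomm i p hp]
  ring

end IsDerivationOn

end Derivation

section Operators

variable {D : Set (Pt n)}

theorem dz_eq_wirtinger (f : Pt n → ℂ) (k : Fin n) : dz f k =
    wirtinger (-I) ((Pi.single k 1 : Fin n → ℂ), (0 : Fin n → ℂ))
      ((Pi.single k I : Fin n → ℂ), (0 : Fin n → ℂ)) f := by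
  funext p
  simp only [dz, wirtinger]
  ring

theorem de_eq_wirtinger (f : Pt n → ℂ) (k : Fin n) : de f k =
    wirtinger (-I) ((0 : Fin n → ℂ), (Pi.single k 1 : Fin n → ℂ))
      ((0 : Fin n → ℂ), (Pi.single k I : Fin n → ℂ)) f := by
  funext p
  simp only [de, wirtinger]
  ring

theorem debar_eq_wirtinger (f : Pt n → ℂ) (k : Fin n) : debar f k =
    wirtinger I ((0 : Fin n → ℂ), (Pi.single k 1 : Fin n → ℂ))
      ((0 : Fin n → ℂ), (Pi.single k I : Fin n → ℂ)) f := rfl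

theorem isDerivationOn_dz (hD : IsOpen D) (k : Fin n) :
    IsDerivationOn D (fun f => dz f k) := by
  simp only [dz_eq_wirtinger]
  exact isDerivationOn_wirtinger hD _ _ _

theorem isDerivationOn_de (hD : IsOpen D) (k : Fin n) :
    IsDerivationOn D (fun f => de f k) := by
  simp only [de_eq_wirtinger]
  exact isDerivationOn_wirtinger hD _ _ _

theorem isDerivationOn_debar (hD : IsOpen D) (k : Fin n) :
    IsDerivationOn D (fun f => debar f k) := by
  simp only [debar_eq_wirtinger]
  exact isDerivationOn_wirtinger hD _ _ _

variable {f : Pt n → ℂ} {p : Pt n}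

theorem de_de_comm (hD : IsOpen D) (hf : ContDiffOn ℝ (⊤ : ℕ∞) f D) (hp : p ∈ D) (i j : Fin n) :
    de (de f i) j p = de (de f j) i p := by
  simp only [de_eq_wirtinger]
  exact wirtinger_comm hD hf _ _ _ _ _ _ hp

theorem de_debar_comm (hD : IsOpen D) (hf : ContDiffOn ℝ (⊤ : ℕ∞) f D) (hp : p ∈ D)
    (i j : Fin n) : de (debar f i) j p = debar (de f j) i p := by
  simp only [de_eq_wirtinger, debar_eq_wirtinger]
  exact wirtinger_comm hD hf _ _ _ _ _ _ hp

theorem de_dz_comm (hD : IsOpen D) (hf : ContDiffOn ℝ (⊤ : ℕ∞) f D) (hp : p ∈ D)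
    (i j : Fin n) : de (dz f i) j p = dz (de f j) i p := by
  simp only [de_eq_wirtinger, dz_eq_wirtinger]
  exact wirtinger_comm hD hf _ _ _ _ _ _ hp

/-- The fibre coordinate `η^i`. -/
def eta (i : Fin n) (p : Pt n) : ℂ := p.2 i

/-- The conjugate fibre coordinate `η̄^i`. -/
def etabar (i : Fin n) (p : Pt n) : ℂ := (starRingEnd ℂ) (p.2 i)

theorem hasFDerivAt_eta (i : Fin n) (p : Pt n) : HasFDerivAt (eta i)
    ((ContinuousLinearMap.proj (R := ℝ) (φ := fun _ : Fin n => ℂ) i).comp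
      (ContinuousLinearMap.snd ℝ (Fin n → ℂ) (Fin n → ℂ))) p :=
  ContinuousLinearMap.hasFDerivAt
    ((ContinuousLinearMap.proj (R := ℝ) (φ := fun _ : Fin n => ℂ) i).comp
      (ContinuousLinearMap.snd ℝ (Fin n → ℂ) (Fin n → ℂ)))

theorem hasFDerivAt_etabar (i : Fin n) (p : Pt n) : HasFDerivAt (etabar i)
    ((conjCLE : ℂ →L[ℝ] ℂ).comp
    ((ContinuousLinearMap.proj (R := ℝ) (φ := fun _ : Fin n => ℂ) i).comp
      (ContinuousLinearMap.snd ℝ (Fin n → ℂ) (Fin n → ℂ)))) p :=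
  ContinuousLinearMap.hasFDerivAt ((conjCLE : ℂ →L[ℝ] ℂ).comp
    ((ContinuousLinearMap.proj (R := ℝ) (φ := fun _ : Fin n => ℂ) i).comp
      (ContinuousLinearMap.snd ℝ (Fin n → ℂ) (Fin n → ℂ))))

theorem contDiffOn_eta (i : Fin n) : ContDiffOn ℝ (⊤ : ℕ∞) (eta i) D :=
  (ContinuousLinearMap.contDiff
    ((ContinuousLinearMap.proj (R := ℝ) (φ := fun _ : Fin n => ℂ) i).comp
      (ContinuousLinearMap.snd ℝ (Fin n → ℂ) (Fin n → ℂ)))).contDiffOn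

theorem contDiffOn_etabar (i : Fin n) : ContDiffOn ℝ (⊤ : ℕ∞) (etabar i) D :=
  (ContinuousLinearMap.contDiff ((conjCLE : ℂ →L[ℝ] ℂ).comp
    ((ContinuousLinearMap.proj (R := ℝ) (φ := fun _ : Fin n => ℂ) i).comp
      (ContinuousLinearMap.snd ℝ (Fin n → ℂ) (Fin n → ℂ))))).contDiffOn

theorem dz_eta (i k : Fin n) (p : Pt n) : dz (eta i) k p = 0 := by
  simp [dz, (hasFDerivAt_eta i p).fderiv]

theorem de_eta (i k : Fin n) (p : Pt n) : de (eta i) k p = if i = k then 1 else 0 := by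
  rcases eq_or_ne i k with rfl | h
  · simp [de, (hasFDerivAt_eta i p).fderiv]
    norm_num
  · simp [de, (hasFDerivAt_eta i p).fderiv, h]

theorem debar_eta (i k : Fin n) (p : Pt n) : debar (eta i) k p = 0 := by
  rcases eq_or_ne i k with rfl | h
  · simp [debar, (hasFDerivAt_eta i p).fderiv]
  · simp [debar, (hasFDerivAt_eta i p).fderiv, h]

theorem dz_etabar (i k : Fin n) (p : Pt n) : dz (etabar i) k p = 0 := by
  simp [dz, (hasFDerivAt_etabar i p).fderiv]

theorem de_etabar (i k : Fin n) (p : Pt n) : de (etabar i) k p = 0 := by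
  rcases eq_or_ne i k with rfl | h
  · simp [de, (hasFDerivAt_etabar i p).fderiv]
  · simp [de, (hasFDerivAt_etabar i p).fderiv, h]

end Operators

section Operators

variable {D : Set (Pt n)} {f : Pt n → ℂ}

theorem contDiffOn_dz (hD : IsOpen D) (hf : ContDiffOn ℝ (⊤ : ℕ∞) f D) (k : Fin n) :
    ContDiffOn ℝ (⊤ : ℕ∞) (dz f k) D := (isDerivationOn_dz hD k).smooth hf

theorem contDiffOn_de (hD : IsOpen D) (hf : ContDiffOn ℝ (⊤ : ℕ∞) f D) (k : Fin n) :
    ContDiffOn ℝ (⊤ : ℕ∞) (de f k) D := (isDerivationOn_de hD k).smooth hf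

theorem contDiffOn_debar (hD : IsOpen D) (hf : ContDiffOn ℝ (⊤ : ℕ∞) f D) (k : Fin n) :
    ContDiffOn ℝ (⊤ : ℕ∞) (debar f k) D := (isDerivationOn_debar hD k).smooth hf

theorem fderiv_fiber_eq_sum (f : Pt n → ℂ) (p : Pt n) (v : Fin n → ℂ) :
    fderiv ℝ f p (0, v) =
      ∑ k, (de f k p * v k + debar f k p * (starRingEnd ℂ) (v k)) := by
  have hv : ((0 : Fin n → ℂ), v) = ∑ k, ((v k).re • ((0 : Fin n → ℂ), (Pi.single k 1 : Fin n → ℂ))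
      + (v k).im • ((0 : Fin n → ℂ), (Pi.single k I : Fin n → ℂ))) := by
    ext i
    · simp [Prod.fst_sum]
    · simp [Prod.snd_sum, Finset.sum_apply, Pi.single_apply, Finset.sum_add_distrib]
  conv_lhs => rw [hv]
  rw [map_sum]
  refine Finset.sum_congr rfl fun k _ => ?_
  rw [map_add, map_smul, map_smul]
  simp only [de, debar, real_smul]
  have h := re_add_im (v k)
  have hc : (starRingEnd ℂ) (v k) = (v k).re - (v k).im * I := by
    apply Complex.ext <;> simp
  rw [hc]
  conv_rhs => rw [← h]
  simp only [add_re, ofReal_re, mul_re, I_re, mul_zero, ofReal_im, I_im, mul_one, sub_self,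
    add_zero, add_im, mul_im, zero_add]
  linear_combination ((fderiv ℝ f p (0, Pi.single k I)) * (v k).im) * I_sq

end Operators

namespace IsCFM

variable {L} {D : Set (Pt n)} {p : Pt n}

theorem fderiv_fiber_smul (hL : IsCFM n D L) (hp : p ∈ D) (c : ℂ) :
    fderiv ℝ L p (0, c • p.2) = 2 * c.re * L p := by
  have hd := ((hL.smooth.contDiffAt (hL.openD.mem_nhds hp)).differentiableAt
    (by simp)).hasFDerivAt
  have hγ : HasDerivAt (fun t : ℝ => p + t • ((0 : Fin n → ℂ), c • p.2))
      ((0 : Fin n → ℂ), c • p.2) 0 := by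
    simpa using ((hasDerivAt_id (0 : ℝ)).smul_const ((0 : Fin n → ℂ), c • p.2)).const_add p
  have h1 : HasDerivAt (fun t : ℝ => L (p + t • ((0 : Fin n → ℂ), c • p.2)))
      (fderiv ℝ L p (0, c • p.2)) 0 := by
    refine HasFDerivAt.comp_hasDerivAt (0 : ℝ) (l := L) ?_ hγ
    simpa using hd
  have h2 : HasDerivAt (fun t : ℝ => (((1 + t * c.re) ^ 2 + (t * c.im) ^ 2 : ℝ) : ℂ) * L p)
      (((2 * c.re : ℝ) : ℂ) * L p) 0 := by
    refine HasDerivAt.mul_const (HasDerivAt.ofReal_comp ?_) _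
    have ha := (((hasDerivAt_id (0 : ℝ)).mul_const c.re).const_add 1).pow 2
    have hb := ((hasDerivAt_id (0 : ℝ)).mul_const c.im).pow 2
    refine (ha.add hb).congr_deriv ?_
    simp
  have hev : (fun t : ℝ => L (p + t • ((0 : Fin n → ℂ), c • p.2))) =ᶠ[nhds 0]
      fun t : ℝ => (((1 + t * c.re) ^ 2 + (t * c.im) ^ 2 : ℝ) : ℂ) * L p := by
    have hcont : ContinuousAt (fun t : ℝ => (1 + t * c : ℂ)) 0 := by fun_prop
    have hne : ∀ᶠ t : ℝ in nhds 0, (1 + t * c : ℂ) ≠ 0 :=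
      hcont.eventually_ne (by simp)
    filter_upwards [hne] with t ht
    have := hL.homog p hp _ ht
    convert this using 2
    · ext i <;> simp [add_mul, mul_assoc]
    · simp [normSq_apply, pow_two]
  exact h1.unique (h2.congr_of_eventuallyEq hev) |>.trans (by push_cast; ring)

theorem euler_de (hL : IsCFM n D L) : ∀ p ∈ D, ∑ k, eta k p * de L k p = L p := by
  intro p hp
  have h1 := hL.fderiv_fiber_smul hp 1
  have h2 := hL.fderiv_fiber_smul hp I
  rw [fderiv_fiber_eq_sum] at h1 h2
  simp only [Finset.sum_add_distrib, Pi.smul_apply, smul_eq_mul, map_mul, one_mul, conj_I,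
    one_re, I_re] at h1 h2
  have e1 : ∑ k, de L k p * (I * p.2 k) = I * ∑ k, de L k p * p.2 k := by
    rw [Finset.mul_sum]; exact Finset.sum_congr rfl fun k _ => by ring
  have e2 : ∑ k, debar L k p * (-I * (starRingEnd ℂ) (p.2 k)) =
      -I * ∑ k, debar L k p * (starRingEnd ℂ) (p.2 k) := by
    rw [Finset.mul_sum]; exact Finset.sum_congr rfl fun k _ => by ring
  rw [e1, e2] at h2
  have e3 : ∑ k, eta k p * de L k p = ∑ k, de L k p * p.2 k :=
    Finset.sum_congr rfl fun k _ => mul_comm _ _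
  rw [e3]
  push_cast at h1 h2
  linear_combination (1 / 2) * h1 - (I / 2) * h2 + (1 / 2) *
    (∑ k, de L k p * p.2 k - ∑ k, debar L k p * (starRingEnd ℂ) (p.2 k)) * I_sq

theorem euler_debar (hL : IsCFM n D L) : ∀ p ∈ D, ∑ k, etabar k p * debar L k p = L p := by
  intro p hp
  have h1 := hL.fderiv_fiber_smul hp 1
  have h2 := hL.euler_de p hp
  rw [fderiv_fiber_eq_sum] at h1
  simp only [one_smul, Finset.sum_add_distrib, one_re] at h1
  have e3 : ∑ k, eta k p * de L k p = ∑ k, de L k p * p.2 k :=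
    Finset.sum_congr rfl fun k _ => mul_comm _ _
  have e4 : ∑ k, etabar k p * debar L k p = ∑ k, debar L k p * (starRingEnd ℂ) (p.2 k) :=
    Finset.sum_congr rfl fun k _ => mul_comm _ _
  rw [e4]
  rw [e3] at h2
  push_cast at h1
  linear_combination h1 - h2

theorem contDiffOn_gm (hL : IsCFM n D L) (i j : Fin n) :
    ContDiffOn ℝ (⊤ : ℕ∞) (gm L i j) D :=
  contDiffOn_de hL.openD (contDiffOn_debar hL.openD hL.smooth j) i

/-- `η^l g_{l m̄} = ∂L/∂η̄^m`. -/
theorem sum_eta_gm (hL : IsCFM n D L) (m : Fin n) :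
    ∀ p ∈ D, ∑ l, eta l p * gm L l m p = debar L m p :=
  (isDerivationOn_debar hL.openD m).euler (e := fun i f => de f i) (f := L)
    (fun i => contDiffOn_eta i) (fun i p _ => debar_eta i m p)
    (fun i => contDiffOn_de hL.openD hL.smooth i)
    (fun i _ hp => (de_debar_comm hL.openD hL.smooth hp m i).symm) hL.euler_de

/-- `η^l ∂g_{l m̄}/∂z^k = ∂²L/∂z^k∂η̄^m`. -/
theorem sum_eta_dz_gm (hL : IsCFM n D L) (m k : Fin n) (hp : p ∈ D) :
    ∑ l, eta l p * dz (gm L l m) k p = dz (debar L m) k p := by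
  have h := (isDerivationOn_dz hL.openD k).congr (hL.sum_eta_gm m) p hp
  rw [(isDerivationOn_dz hL.openD k).sum_mul _ (fun i => contDiffOn_eta i)
    (fun i => hL.contDiffOn_gm i m) hp] at h
  simpa [dz_eta] using h

theorem de_gm_comm (hL : IsCFM n D L) (i m j : Fin n) (hp : p ∈ D) :
    de (gm L i m) j p = de (gm L j m) i p :=
  de_de_comm hL.openD (contDiffOn_debar hL.openD hL.smooth m) hp i j

/-- `η^l ∂g_{l m̄}/∂η^k = 0`. -/
theorem sum_eta_de_gm (hL : IsCFM n D L) (m k : Fin n) (hp : p ∈ D) :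
    ∑ l, eta l p * de (gm L l m) k p = 0 := by
  have h := (isDerivationOn_de hL.openD k).congr (hL.sum_eta_gm m) p hp
  rw [(isDerivationOn_de hL.openD k).sum_mul _ (fun i => contDiffOn_eta i)
    (fun i => hL.contDiffOn_gm i m) hp] at h
  simp only [de_eta, Finset.sum_add_distrib, ite_mul, one_mul, zero_mul, Finset.sum_ite_eq',
    Finset.mem_univ, if_true] at h
  exact add_eq_left.mp h

theorem sum_etabar_de (hL : IsCFM n D L) {f : Pt n → ℂ} (hf : ContDiffOn ℝ (⊤ : ℕ∞) f D)
    (h : ∀ p ∈ D, ∑ m, etabar m p * debar f m p = f p) (k : Fin n) :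
    ∀ p ∈ D, ∑ m, etabar m p * debar (de f k) m p = de f k p :=
  (isDerivationOn_de hL.openD k).euler (e := fun i f => debar f i) (f := f)
    (fun i => contDiffOn_etabar i) (fun i p _ => de_etabar i k p)
    (fun i => contDiffOn_debar hL.openD hf i)
    (fun i _ hp => de_debar_comm hL.openD hf hp i k) h

/-- `η̄^m g_{i m̄} = ∂L/∂η^i`. -/
theorem sum_etabar_gm (hL : IsCFM n D L) (i : Fin n) :
    ∀ p ∈ D, ∑ m, etabar m p * gm L i m p = de L i p := by
  intro p hp
  rw [← hL.sum_etabar_de hL.smooth hL.euler_debar i p hp]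
  exact Finset.sum_congr rfl fun m _ => by
    rw [gm, de_debar_comm hL.openD hL.smooth hp m i]

/-- If `η̄^m f_m = h` on `D` then `η̄^m ∂f_m/∂η^k = ∂h/∂η^k` on `D`. -/
theorem sum_etabar_de_of_eq (hL : IsCFM n D L) {f : Fin n → Pt n → ℂ} {h : Pt n → ℂ}
    (hf : ∀ m, ContDiffOn ℝ (⊤ : ℕ∞) (f m) D)
    (hfh : ∀ p ∈ D, ∑ m, etabar m p * f m p = h p) (k : Fin n) :
    ∀ p ∈ D, ∑ m, etabar m p * de (f m) k p = de h k p := by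
  intro p hp
  have h := (isDerivationOn_de hL.openD k).congr hfh p hp
  rw [(isDerivationOn_de hL.openD k).sum_mul _ (fun i => contDiffOn_etabar i) hf hp] at h
  simpa [de_etabar] using h

/-- If `η̄^m f_m = h` on `D` then `η̄^m ∂f_m/∂z^k = ∂h/∂z^k` on `D`. -/
theorem sum_etabar_dz_of_eq (hL : IsCFM n D L) {f : Fin n → Pt n → ℂ} {h : Pt n → ℂ}
    (hf : ∀ m, ContDiffOn ℝ (⊤ : ℕ∞) (f m) D)
    (hfh : ∀ p ∈ D, ∑ m, etabar m p * f m p = h p) (k : Fin n) :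
    ∀ p ∈ D, ∑ m, etabar m p * dz (f m) k p = dz h k p := by
  intro p hp
  have h := (isDerivationOn_dz hL.openD k).congr hfh p hp
  rw [(isDerivationOn_dz hL.openD k).sum_mul _ (fun i => contDiffOn_etabar i) hf hp] at h
  simpa [dz_etabar] using h

theorem det_ne_zero (hL : IsCFM n D L) (hp : p ∈ D) : (gmat L p).det ≠ 0 := by
  intro h
  obtain ⟨v, hv, h0⟩ := Matrix.exists_vecMul_eq_zero_iff.2 h
  have := hL.posdef p hp v hv
  have hz : ∑ i, ∑ j, gm L i j p * v i * (starRingEnd ℂ) (v j) =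
      ∑ j, (Matrix.vecMul v (gmat L p)) j * (starRingEnd ℂ) (v j) := by
    rw [Finset.sum_comm]
    refine Finset.sum_congr rfl fun j _ => ?_
    rw [Matrix.vecMul, dotProduct, Finset.sum_mul]
    exact Finset.sum_congr rfl fun i _ => by rw [gmat]; ring
  rw [hz, h0] at this
  simp at this

/-- `g_{i m̄} g^{l̄ i} = δ_{lm}`. -/
theorem sum_gi_gm (hL : IsCFM n D L) (l m : Fin n) (hp : p ∈ D) :
    ∑ i, gi L l i p * gm L i m p = if l = m then 1 else 0 := by
  have := Matrix.nonsing_inv_mul (gmat L p) (isUnit_iff_ne_zero.2 (hL.det_ne_zero hp))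
  have h := congrFun (congrFun this l) m
  rwa [Matrix.mul_apply, Matrix.one_apply] at h

/-- Lowering an index undoes raising it. -/
theorem sum_gm_raise (hL : IsCFM n D L) (x : Fin n → ℂ) (m : Fin n) (hp : p ∈ D) :
    ∑ i, gm L i m p * ∑ l, gi L l i p * x l = x m := by
  have : ∀ i, gm L i m p * ∑ l, gi L l i p * x l =
      ∑ l, gi L l i p * gm L i m p * x l := fun i => by
    rw [Finset.mul_sum]; exact Finset.sum_congr rfl fun l _ => by ring
  simp only [this]
  rw [Finset.sum_comm]
  simp only [← Finset.sum_mul, hL.sum_gi_gm _ m hp]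
  simp

/-- `g_{i m̄} N^i_k = ∂²L/∂z^k∂η̄^m`. -/
theorem sum_gm_Nc (hL : IsCFM n D L) (m k : Fin n) :
    ∀ p ∈ D, ∑ i, gm L i m p * Nc L i k p = dz (debar L m) k p := by
  intro p hp
  have h : ∀ i, Nc L i k p = ∑ l, gi L l i p * dz (debar L l) k p := fun i => by
    rw [Nc]
    refine Finset.sum_congr rfl fun l _ => ?_
    rw [← hL.sum_eta_dz_gm l k hp, Finset.mul_sum]
    exact Finset.sum_congr rfl fun j _ => by rw [eta]; ring
  simp only [h]
  exact hL.sum_gm_raise _ m hp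

end IsCFM

section Derivation

variable {E : Type*} [NormedAddCommGroup E] [NormedSpace ℝ E] {D : Set E}
  {d : (E → ℂ) → E → ℂ}

theorem IsDerivationOn.const_mul (hd : IsDerivationOn D d) (a : ℂ) {f : E → ℂ}
    (hf : ContDiffOn ℝ (⊤ : ℕ∞) f D) {p : E} (hp : p ∈ D) :
    d (fun q => a * f q) p = a * d f p := by
  rw [hd.mul contDiffOn_const hf p hp, hd.const]
  ring

theorem IsDerivationOn.sub (hd : IsDerivationOn D d) {f g : E → ℂ}
    (hf : ContDiffOn ℝ (⊤ : ℕ∞) f D) (hg : ContDiffOn ℝ (⊤ : ℕ∞) g D) {p : E} (hp : p ∈ D) :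
    d (fun q => f q - g q) p = d f p - d g p := by
  rw [hd.congr (g := fun q => f q + -1 * g q) (fun q _ => by ring) p hp,
    hd.add hf (contDiffOn_const.mul hg) p hp, hd.const_mul _ hg hp]
  ring

theorem contDiffOn_det {ι : Type*} [Fintype ι] [DecidableEq ι] {M : E → Matrix ι ι ℂ}
    (hM : ∀ i j, ContDiffOn ℝ (⊤ : ℕ∞) (fun p => M p i j) D) :
    ContDiffOn ℝ (⊤ : ℕ∞) (fun p => (M p).det) D := by
  simp only [Matrix.det_apply']
  exact ContDiffOn.sum fun σ _ => contDiffOn_const.mul (contDiffOn_prod fun i _ => hM _ _)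

theorem contDiffOn_matrix_inv {ι : Type*} [Fintype ι] [DecidableEq ι] {M : E → Matrix ι ι ℂ}
    (hM : ∀ i j, ContDiffOn ℝ (⊤ : ℕ∞) (fun p => M p i j) D) (h0 : ∀ p ∈ D, (M p).det ≠ 0)
    (i j : ι) : ContDiffOn ℝ (⊤ : ℕ∞) (fun p => (M p)⁻¹ i j) D := by
  simp only [Matrix.inv_def, Matrix.smul_apply, Matrix.adjugate_apply, Ring.inverse_eq_inv',
    smul_eq_mul]
  refine ((contDiffOn_det hM).inv h0).mul (contDiffOn_det fun k l => ?_)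
  by_cases hk : k = j
  · subst hk
    simpa using contDiffOn_const
  · simpa [Matrix.updateRow_apply, hk] using hM k l

end Derivation

namespace IsCFM

variable {L} {D : Set (Pt n)} {p : Pt n}

theorem contDiffOn_Nc (hL : IsCFM n D L) (i k : Fin n) :
    ContDiffOn ℝ (⊤ : ℕ∞) (Nc L i k) D :=
  ContDiffOn.sum fun m _ => ContDiffOn.sum fun l _ =>
    ((contDiffOn_matrix_inv (fun i j => hL.contDiffOn_gm i j) (fun _ hp => hL.det_ne_zero hp)
      m i).mul (contDiffOn_dz hL.openD (hL.contDiffOn_gm l m) k)).mul (contDiffOn_eta l)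

theorem contDiffOn_del (hL : IsCFM n D L) {f : Pt n → ℂ} (hf : ContDiffOn ℝ (⊤ : ℕ∞) f D)
    (k : Fin n) : ContDiffOn ℝ (⊤ : ℕ∞) (del L f k) D :=
  (contDiffOn_dz hL.openD hf k).sub
    (ContDiffOn.sum fun j _ => (hL.contDiffOn_Nc j k).mul (contDiffOn_de hL.openD hf j))

theorem de_del (hL : IsCFM n D L) {f : Pt n → ℂ} (hf : ContDiffOn ℝ (⊤ : ℕ∞) f D)
    (k a : Fin n) (hp : p ∈ D) :
    de (del L f k) a p = dz (de f a) k p -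
      ∑ j, (de (Nc L j k) a p * de f j p + Nc L j k p * de (de f a) j p) := by
  have hd := isDerivationOn_de hL.openD a
  change de (fun q => dz f k q - ∑ j, Nc L j k q * de f j q) a p = _
  rw [hd.sub (contDiffOn_dz hL.openD hf k) (ContDiffOn.sum fun j _ =>
      (hL.contDiffOn_Nc j k).mul (contDiffOn_de hL.openD hf j)) hp,
    hd.sum_mul _ (fun j => hL.contDiffOn_Nc j k) (fun j => contDiffOn_de hL.openD hf j) hp,
    de_dz_comm hL.openD hf hp]
  congr 1
  exact Finset.sum_congr rfl fun j _ => by rw [de_de_comm hL.openD hf hp j a]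

/-- Raising an index undoes lowering it. -/
theorem sum_raise_gm (hL : IsCFM n D L) (x : Fin n → ℂ) (i : Fin n) (hp : p ∈ D) :
    ∑ l, gi L l i p * ∑ s, gm L s l p * x s = x i := by
  have h1 := Matrix.mul_nonsing_inv (gmat L p) (isUnit_iff_ne_zero.2 (hL.det_ne_zero hp))
  have h2 : ∀ s, ∑ l, gm L s l p * gi L l i p = if s = i then 1 else 0 := fun s => by
    have h := congrFun (congrFun h1 s) i
    rwa [Matrix.mul_apply, Matrix.one_apply] at h
  have : ∀ l, gi L l i p * ∑ s, gm L s l p * x s =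
      ∑ s, gm L s l p * gi L l i p * x s := fun l => by
    rw [Finset.mul_sum]; exact Finset.sum_congr rfl fun l _ => by ring
  simp only [this]
  rw [Finset.sum_comm]
  simp only [← Finset.sum_mul, h2]
  simp

/-- `g_{i m̄} ∂N^i_l/∂η^j = δ_l g_{j m̄}`. -/
theorem sum_gm_de_Nc (hL : IsCFM n D L) (m l j : Fin n) :
    ∀ p ∈ D, ∑ i, gm L i m p * de (Nc L i l) j p = del L (gm L j m) l p := by
  intro p hp
  have hd := isDerivationOn_de hL.openD j
  have h := hd.congr (hL.sum_gm_Nc m l) p hp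
  rw [hd.sum_mul _ (fun i => hL.contDiffOn_gm i m) (fun i => hL.contDiffOn_Nc i l) hp,
    de_dz_comm hL.openD (contDiffOn_debar hL.openD hL.smooth m) hp, Finset.sum_add_distrib] at h
  rw [del, eq_sub_iff_add_eq, add_comm]
  refine Eq.trans ?_ h
  congr 1
  exact Finset.sum_congr rfl fun i _ => by rw [hL.de_gm_comm i m j hp, mul_comm]

theorem sum_gm_de_de_Nc (hL : IsCFM n D L) (m l j k : Fin n) (hp : p ∈ D) :
    ∑ i, (de (gm L i m) k p * de (Nc L i l) j p + gm L i m p * de (de (Nc L i l) j) k p) =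
      dz (de (gm L j m) k) l p - ∑ s, (de (Nc L s l) k p * de (gm L j m) s p +
        Nc L s l p * de (de (gm L j m) k) s p) := by
  have hd := isDerivationOn_de hL.openD k
  rw [← hL.de_del (hL.contDiffOn_gm j m) l k hp, ← hd.congr (hL.sum_gm_de_Nc m l j) p hp,
    hd.sum_mul _ (fun i => hL.contDiffOn_gm i m)
      (fun i => contDiffOn_de hL.openD (hL.contDiffOn_Nc i l) j) hp]

theorem de_Gs (hL : IsCFM n D L) (i k : Fin n) :
    ∀ p ∈ D, de (Gs L i) k p = (1 / 2) * (∑ j, de (Nc L i j) k p * eta j p + Nc L i k p) := by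
  intro p hp
  have hd := isDerivationOn_de hL.openD k
  change de (fun q => (1 / 2) * ∑ j, Nc L i j q * eta j q) k p = _
  rw [hd.const_mul _ (ContDiffOn.sum fun j _ => (hL.contDiffOn_Nc i j).mul (contDiffOn_eta j)) hp,
    hd.sum_mul _ (fun j => hL.contDiffOn_Nc i j) (fun j => contDiffOn_eta j) hp]
  simp [de_eta, Finset.sum_add_distrib]

theorem de_de_Gs (hL : IsCFM n D L) (i k j : Fin n) (hp : p ∈ D) :
    de (de (Gs L i) k) j p = (1 / 2) * (∑ l, de (de (Nc L i l) k) j p * eta l p +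
      de (Nc L i j) k p + de (Nc L i k) j p) := by
  have hd := isDerivationOn_de hL.openD j
  have hs : ∀ l, ContDiffOn ℝ (⊤ : ℕ∞) (de (Nc L i l) k) D :=
    fun l => contDiffOn_de hL.openD (hL.contDiffOn_Nc i l) k
  have hs' : ContDiffOn ℝ (⊤ : ℕ∞) (fun q => ∑ l, de (Nc L i l) k q * eta l q) D :=
    ContDiffOn.sum fun l _ => (hs l).mul (contDiffOn_eta l)
  rw [hd.congr (hL.de_Gs i k) p hp, hd.const_mul _ (hs'.add (hL.contDiffOn_Nc i k)) hp,
    hd.add hs' (hL.contDiffOn_Nc i k) p hp, hd.sum_mul _ hs (fun l => contDiffOn_eta l) hp]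
  simp [de_eta, Finset.sum_add_distrib]

end IsCFM

namespace IsCFM

section General

variable {L} {D : Set (Pt n)} {p : Pt n}

/-- `η̄^m δ_k g_{j m̄} = δ_k (∂L/∂η^j)`. -/
theorem sum_etabar_del_gm (hL : IsCFM n D L) (j k : Fin n) (hp : p ∈ D) :
    ∑ m, etabar m p * del L (gm L j m) k p = del L (de L j) k p := by
  have h1 := hL.sum_etabar_dz_of_eq (fun m => hL.contDiffOn_gm j m) (hL.sum_etabar_gm j) k p hp
  have h2 := fun s =>
    hL.sum_etabar_de_of_eq (fun m => hL.contDiffOn_gm j m) (hL.sum_etabar_gm j) s p hp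
  simp only [del, mul_sub, Finset.sum_sub_distrib, h1, Finset.mul_sum, ← h2]
  rw [Finset.sum_comm]
  congr 1
  exact Finset.sum_congr rfl fun _ _ => Finset.sum_congr rfl fun _ _ => by ring

/-- `η^j δ_k g_{j m̄} = ∂²L/∂z^k∂η̄^m`. -/
theorem sum_eta_del_gm (hL : IsCFM n D L) (m k : Fin n) (hp : p ∈ D) :
    ∑ j, eta j p * del L (gm L j m) k p = dz (debar L m) k p := by
  simp only [del, mul_sub, Finset.sum_sub_distrib, hL.sum_eta_dz_gm m k hp, Finset.mul_sum]
  rw [Finset.sum_comm, sub_eq_self]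
  refine Finset.sum_eq_zero fun s _ => ?_
  have : ∀ j, eta j p * (Nc L s k p * de (gm L j m) s p) =
      Nc L s k p * (eta j p * de (gm L j m) s p) := fun j => by ring
  simp only [this, ← Finset.mul_sum, hL.sum_eta_de_gm m s hp, mul_zero]

/-- `δ_k (∂L/∂η̄^m) = 0`. -/
theorem del_debar (hL : IsCFM n D L) (m k : Fin n) (hp : p ∈ D) :
    del L (debar L m) k p = 0 := by
  rw [del, ← hL.sum_gm_Nc m k p hp, sub_eq_zero]
  exact Finset.sum_congr rfl fun i _ => by rw [gm, mul_comm]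

end General

variable {L : Pt 2 → ℂ} {D : Set (Pt 2)} {p : Pt 2}

/-- For a weakly Kähler metric, `η^j δ_j (∂L/∂η^k) = ∂L/∂z^k`. -/
theorem sum_eta_del_de (hL : IsCFM 2 D L) (hwK : IsWeaklyKahler L D) (k : Fin 2) :
    ∀ p ∈ D, ∑ j, eta j p * del L (de L k) j p = dz L k p := by
  intro p hp
  have h := hwK p hp k
  have r : ∀ l j k, ∑ i, gm L i l p * Lc L i j k p = del L (gm L j l) k p :=
    fun l j k => hL.sum_gm_raise (fun l => del L (gm L j l) k p) l hp
  have h1 := fun j => hL.sum_etabar_del_gm k j hp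
  have h2 := fun m => hL.sum_eta_del_gm m k hp
  have h3 := hL.sum_etabar_dz_of_eq (fun m => contDiffOn_debar hL.openD hL.smooth m)
    hL.euler_debar k p hp
  change (∑ i, ∑ j, ∑ l, gm L i l p * (Lc L i j k p - Lc L i k j p) *
    eta j p * etabar l p) = 0 at h
  simp only [Fin.sum_univ_two] at h r h1 h2 h3 ⊢
  linear_combination -h + eta 0 p * etabar 0 p * (r 0 0 k - r 0 k 0) +
    eta 0 p * etabar 1 p * (r 1 0 k - r 1 k 0) + eta 1 p * etabar 0 p * (r 0 1 k - r 0 k 1) +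
    eta 1 p * etabar 1 p * (r 1 1 k - r 1 k 1) + etabar 0 p * h2 0 + etabar 1 p * h2 1 + h3
    - eta 0 p * h1 0 - eta 1 p * h1 1

theorem Fh_ne_zero (hL : IsCFM 2 D L) (hp : p ∈ D) : Fh L p ≠ 0 :=
  ofReal_ne_zero.2 (Real.sqrt_pos.2 (hL.pos p hp)).ne'

theorem sg_ne_zero (hL : IsCFM 2 D L) (hp : p ∈ D) : sg L p ≠ 0 := by
  refine ofReal_ne_zero.2 (Real.sqrt_pos.2 ?_).ne'
  have h0 := hL.posdef p hp (Pi.single 0 1) (by simp)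
  have hv : ![-gm L 1 0 p, gm L 0 0 p] ≠ 0 := by
    intro h
    have := congrFun h 1
    simp only [Matrix.cons_val_one, Matrix.cons_val_fin_one, Pi.zero_apply] at this
    simp [this, Fin.sum_univ_two] at h0
  have h1 := hL.posdef p hp _ hv
  have h00 : (gm L 0 0 p).im = 0 := conj_eq_iff_im.1 (hL.hermitian p hp 0 0)
  have e : ∑ i, ∑ j, gm L i j p * ![-gm L 1 0 p, gm L 0 0 p] i *
      (starRingEnd ℂ) (![-gm L 1 0 p, gm L 0 0 p] j) = gm L 0 0 p * (gmat L p).det := by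
    simp only [Fin.sum_univ_two, Matrix.cons_val_zero, Matrix.cons_val_one,
      Matrix.cons_val_fin_one, map_neg, hL.hermitian p hp, Matrix.det_fin_two, gmat]
    ring
  have h0' : 0 < (gm L 0 0 p).re := by
    simpa [Fin.sum_univ_two] using h0
  rw [e, mul_re, h00, zero_mul, sub_zero] at h1
  exact (pos_iff_pos_of_mul_pos h1).1 h0'

theorem conj_de (hL : IsCFM 2 D L) (i : Fin 2) (hp : p ∈ D) :
    (starRingEnd ℂ) (de L i p) = debar L i p := by
  rw [← hL.sum_etabar_gm i p hp, ← hL.sum_eta_gm i p hp, map_sum]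
  refine Finset.sum_congr rfl fun m _ => ?_
  rw [map_mul, hL.hermitian p hp, etabar, conj_conj, eta]

/-- If `B = 0` then `m̄^l ∂g_{j l̄}/∂η^k = 0`, up to a nonzero factor. -/
theorem wedge_de_gm (hL : IsCFM 2 D L) (hB : ∀ p ∈ D, sB L p = 0) (j k : Fin 2) :
    ∀ p ∈ D, debar L 0 p * de (gm L j 1) k p - debar L 1 p * de (gm L j 0) k p = 0 := by
  intro p hp
  set t : ℂ := (Fh L p * sg L p)⁻¹ with ht
  have ht0 : t ≠ 0 := inv_ne_zero (mul_ne_zero (hL.Fh_ne_zero hp) (hL.sg_ne_zero hp))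
  have hl : ∀ i, llow L i p = de L i p / Fh L p := fun i => by
    rw [llow, ← hL.sum_etabar_gm i p hp]
    congr 1
    exact Finset.sum_congr rfl fun j _ => mul_comm _ _
  have m0 : mup L 0 p = -t * de L 1 p := by
    rw [mup, if_pos rfl, hl, ht, mul_inv]; ring
  have m1 : mup L 1 p = t * de L 0 p := by
    rw [mup, if_neg (by decide), hl, ht, mul_inv]; ring
  have htc : (starRingEnd ℂ) t = t := by
    rw [ht, map_inv₀, map_mul, Fh, sg, conj_ofReal, conj_ofReal]
  have c0 : (starRingEnd ℂ) (mup L 0 p) = -t * debar L 1 p := by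
    rw [m0, map_mul, map_neg, htc, hL.conj_de 1 hp]
  have c1 : (starRingEnd ℂ) (mup L 1 p) = t * debar L 0 p := by
    rw [m1, map_mul, htc, hL.conj_de 0 hp]
  have r : ∀ l j k, ∑ i, gm L i l p * Cc L i j k p = de (gm L j l) k p :=
    fun l j k => hL.sum_gm_raise (fun l => de (gm L j l) k p) l hp
  have h := hB p hp
  have eu := hL.euler_de p hp
  have hz := fun m k => hL.sum_eta_de_gm m k hp
  have hL0 : L p ≠ 0 := fun h => by simpa [h] using hL.pos p hp
  simp only [sB, mlow, Fin.sum_univ_two, c0, c1] at h r eu hz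
  rw [m0, m1] at h
  have s0 := hL.de_gm_comm 0 0 1 hp
  have s1 := hL.de_gm_comm 0 1 1 hp
  have hvv : t ^ 3 * (de L 1 p ^ 2 * (debar L 0 p * de (gm L 0 1) 0 p -
        debar L 1 p * de (gm L 0 0) 0 p) -
      2 * de L 0 p * de L 1 p * (debar L 0 p * de (gm L 0 1) 1 p -
        debar L 1 p * de (gm L 0 0) 1 p) +
      de L 0 p ^ 2 * (debar L 0 p * de (gm L 1 1) 1 p -
        debar L 1 p * de (gm L 1 0) 1 p)) = 0 := by
    linear_combination h - t ^ 3 * (de L 1 p ^ 2 * (debar L 0 p * r 1 0 0 - debar L 1 p * r 0 0 0) -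
      de L 0 p * de L 1 p * (debar L 0 p * r 1 0 1 - debar L 1 p * r 0 0 1) -
      de L 0 p * de L 1 p * (debar L 0 p * r 1 1 0 - debar L 1 p * r 0 1 0) +
      de L 0 p ^ 2 * (debar L 0 p * r 1 1 1 - debar L 1 p * r 0 1 1)) -
      t ^ 3 * de L 0 p * de L 1 p * (debar L 0 p * s1 - debar L 1 p * s0)
  have hvv' := (mul_eq_zero.1 hvv).resolve_left (pow_ne_zero 3 ht0)
  have key : L p ^ 2 * (debar L 0 p * de (gm L j 1) k p - debar L 1 p * de (gm L j 0) k p) = 0 := by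
    have z0 := congrArg₂ (fun a b => debar L 0 p * a - debar L 1 p * b) (hz 1 0) (hz 0 0)
    have z1 := congrArg₂ (fun a b => debar L 0 p * a - debar L 1 p * b) (hz 1 1) (hz 0 1)
    simp only [← s0, ← s1] at z0
    rw [← eu]
    fin_cases j <;> fin_cases k <;>
      simp only [Fin.zero_eta, Fin.mk_one, ← s0, ← s1]
    · linear_combination de L 0 p ^ 2 * (eta 0 p * z0 + eta 1 p * z1) -
        2 * de L 0 p * eta 1 p * (de L 0 p * z1 - de L 1 p * z0) + eta 1 p ^ 2 * hvv'
    · linear_combination de L 0 p * de L 1 p * (eta 0 p * z0 + eta 1 p * z1) +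
        (de L 0 p * eta 0 p - de L 1 p * eta 1 p) * (de L 0 p * z1 - de L 1 p * z0) -
        eta 0 p * eta 1 p * hvv'
    · linear_combination de L 0 p * de L 1 p * (eta 0 p * z0 + eta 1 p * z1) +
        (de L 0 p * eta 0 p - de L 1 p * eta 1 p) * (de L 0 p * z1 - de L 1 p * z0) -
        eta 0 p * eta 1 p * hvv'
    · linear_combination de L 1 p ^ 2 * (eta 0 p * z0 + eta 1 p * z1) +
        2 * de L 1 p * eta 0 p * (de L 0 p * z1 - de L 1 p * z0) + eta 0 p ^ 2 * hvv'
  exact (mul_eq_zero.1 key).resolve_left (pow_ne_zero 2 hL0)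

end IsCFM

namespace IsCFM

variable {L : Pt 2 → ℂ} {D : Set (Pt 2)} {p : Pt 2}

/-- A covector annihilating both `η̄` and the vector `(-∂L/∂η̄², ∂L/∂η̄¹)` vanishes. -/
theorem eq_of_contract (hL : IsCFM 2 D L) (hp : p ∈ D) {x y : Fin 2 → ℂ}
    (h : ∑ m, etabar m p * x m = ∑ m, etabar m p * y m)
    (h' : debar L 0 p * x 1 - debar L 1 p * x 0 = debar L 0 p * y 1 - debar L 1 p * y 0) :
    x = y := by
  have eu := hL.euler_debar p hp
  have hL0 : L p ≠ 0 := fun h => by simpa [h] using hL.pos p hp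
  simp only [Fin.sum_univ_two] at h eu
  funext i
  apply mul_left_cancel₀ hL0
  rw [← eu]
  fin_cases i <;> simp only [Fin.zero_eta, Fin.mk_one]
  · linear_combination debar L 0 p * h - etabar 1 p * h'
  · linear_combination debar L 1 p * h + etabar 0 p * h'

/-- The `m̄`-component of the vertical derivative of `g` stays zero along horizontal directions. -/
theorem wedge_del_de_gm (hL : IsCFM 2 D L) (hB : ∀ p ∈ D, sB L p = 0) (j k l : Fin 2)
    (hp : p ∈ D) :
    debar L 0 p * del L (de (gm L j 1) k) l p - debar L 1 p * del L (de (gm L j 0) k) l p = 0 := by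
  have key : ∀ d : (Pt 2 → ℂ) → Pt 2 → ℂ, IsDerivationOn D d →
      d (debar L 0) p * de (gm L j 1) k p + debar L 0 p * d (de (gm L j 1) k) p -
        (d (debar L 1) p * de (gm L j 0) k p + debar L 1 p * d (de (gm L j 0) k) p) = 0 := by
    intro d hd
    have hP : ∀ m, ContDiffOn ℝ (⊤ : ℕ∞) (debar L m) D :=
      fun m => contDiffOn_debar hL.openD hL.smooth m
    have hC : ∀ m, ContDiffOn ℝ (⊤ : ℕ∞) (de (gm L j m) k) D :=
      fun m => contDiffOn_de hL.openD (hL.contDiffOn_gm j m) k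
    rw [← hd.mul (hP 0) (hC 1) p hp, ← hd.mul (hP 1) (hC 0) p hp,
      ← hd.sub ((hP 0).mul (hC 1)) ((hP 1).mul (hC 0)) hp,
      hd.congr (hL.wedge_de_gm hB j k) p hp, hd.const]
  have hz := key _ (isDerivationOn_dz hL.openD l)
  have h0 := key _ (isDerivationOn_de hL.openD 0)
  have h1 := key _ (isDerivationOn_de hL.openD 1)
  have e0 := hL.del_debar 0 l hp
  have e1 := hL.del_debar 1 l hp
  simp only [del, Fin.sum_univ_two] at e0 e1 ⊢
  linear_combination hz - Nc L 0 l p * h0 - Nc L 1 l p * h1 - de (gm L j 1) k p * e0 +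
    de (gm L j 0) k p * e1

/-- The derivative of the weak Kähler identity `η^j δ_j (∂L/∂η^k) = ∂L/∂z^k` along `η^a`. -/
theorem de_sum_eta_del_de (hL : IsCFM 2 D L) (hwK : IsWeaklyKahler L D) (k a : Fin 2)
    (hp : p ∈ D) : del L (de L k) a p + ∑ j, eta j p * (dz (de (de L k) a) j p -
      ∑ s, (de (Nc L s j) a p * de (de L k) s p + Nc L s j p * de (de (de L k) a) s p)) =
      dz (de L a) k p := by
  have hd := isDerivationOn_de hL.openD a
  have hk := contDiffOn_de hL.openD hL.smooth k
  have h := hd.congr (hL.sum_eta_del_de hwK k) p hp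
  rw [hd.sum_mul _ (fun j => contDiffOn_eta j) (fun j => hL.contDiffOn_del hk j) hp,
    de_dz_comm hL.openD hL.smooth hp, Finset.sum_add_distrib] at h
  simpa [de_eta, hL.de_del hk _ a hp] using h

end IsCFM

/-- weakly Kähler with `B = 0` implies Landsberg. -/
theorem statement11 (D : Set (Pt 2)) (L : Pt 2 → ℂ) (hL : IsCFM 2 D L)
    (hwK : IsWeaklyKahler L D) (hB : ∀ p ∈ D, sB L p = 0) :
    IsLandsberg L D := by
  intro p hp i j k
  set x : Fin 2 → ℂ := fun i => de (de (Gs L i) k) j p with hx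
  set y : Fin 2 → ℂ := fun l => (1 / 2) * (delc L (gm L j l) k p + delc L (gm L k l) j p) with hy
  set X : Fin 2 → ℂ := fun m => ∑ i, gm L i m p * x i with hX
  suffices h : X = y by
    rw [show de (de (Gs L i) k) j p = x i from rfl, ← hL.sum_raise_gm x i hp, Finset.mul_sum]
    refine Finset.sum_congr rfl fun l _ => ?_
    rw [show ∑ s, gm L s l p * x s = X l from rfl, h, hy]
    ring
  have N1 := fun m l j => hL.sum_gm_de_Nc m l j p hp
  have N2 := fun m l j k => hL.sum_gm_de_de_Nc m l j k hp
  have C := fun i m j => hL.de_gm_comm i m j hp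
  have hdiff : ∀ m, 2 * (X m - y m) = ∑ l, eta l p * (del L (de (gm L k m) j) l p -
      ∑ s, (de (gm L s m) j p * de (Nc L s l) k p + de (gm L s m) k p * de (Nc L s l) j p)) +
      ∑ s, (de (gm L s m) j p * (de (Gs L s) k p - Nc L s k p) +
        de (gm L s m) k p * (de (Gs L s) j p - Nc L s j p)) := by
    intro m
    simp only [hX, hy, hx, hL.de_de_Gs _ k j hp, delc]
    have n1 := N1 m k j
    have n2 := N1 m j k
    have n3 := fun l => N2 m l k j
    simp only [del, Fin.sum_univ_two] at n1 n2 n3 ⊢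
    linear_combination eta 0 p * n3 0 + eta 1 p * n3 1 + n1 + n2 -
      (de (Gs L 0) k p - Nc L 0 k p) * C 0 m j - (de (Gs L 1) k p - Nc L 1 k p) * C 1 m j -
      (de (Gs L 0) j p - Nc L 0 j p) * C 0 m k - (de (Gs L 1) j p - Nc L 1 j p) * C 1 m k +
      (eta 0 p * de (Nc L 0 0) j p + eta 1 p * de (Nc L 0 1) j p) * C 0 m k +
      (eta 0 p * de (Nc L 1 0) j p + eta 1 p * de (Nc L 1 1) j p) * C 1 m k
  refine hL.eq_of_contract hp ?_ ?_
  · have hC : ∀ s a m, ContDiffOn ℝ (⊤ : ℕ∞) (de (gm L s m) a) D :=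
      fun s a m => contDiffOn_de hL.openD (hL.contDiffOn_gm s m) a
    have hE := fun s => hL.sum_etabar_de_of_eq (fun m => hL.contDiffOn_gm s m) (hL.sum_etabar_gm s)
    have E1 := fun s a => hE s a p hp
    have Ez := fun l => hL.sum_etabar_dz_of_eq (hC k j) (hE k j) l p hp
    have Ee := fun l => hL.sum_etabar_de_of_eq (hC k j) (hE k j) l p hp
    have hG := fun s a => hL.de_Gs s a p hp
    have W1 := hL.de_sum_eta_del_de hwK k j hp
    have W2 := hL.de_sum_eta_del_de hwK j k hp
    have hsymm : ∀ q ∈ D, de (de L j) k q = de (de L k) j q :=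
      fun q hq => de_de_comm hL.openD hL.smooth hq j k
    have S := fun s a => de_de_comm hL.openD hL.smooth hp s a
    have Sz := fun l => (isDerivationOn_dz hL.openD l).congr hsymm p hp
    have Se := fun l => (isDerivationOn_de hL.openD l).congr hsymm p hp
    simp only [Sz, Se] at W2
    have d0 := hdiff 0
    have d1 := hdiff 1
    simp only [del, Fin.sum_univ_two] at d0 d1 E1 Ez Ee hG W1 W2 ⊢
    linear_combination (1 / 2) * (etabar 0 p * d0 + etabar 1 p * d1) +
      (1 / 2) * (
        eta 0 p * (Ez 0 - Nc L 0 0 p * Ee 0 - Nc L 1 0 p * Ee 1 -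
          E1 0 j * de (Nc L 0 0) k p - E1 1 j * de (Nc L 1 0) k p -
          E1 0 k * de (Nc L 0 0) j p - E1 1 k * de (Nc L 1 0) j p) +
        eta 1 p * (Ez 1 - Nc L 0 1 p * Ee 0 - Nc L 1 1 p * Ee 1 -
          E1 0 j * de (Nc L 0 1) k p - E1 1 j * de (Nc L 1 1) k p -
          E1 0 k * de (Nc L 0 1) j p - E1 1 k * de (Nc L 1 1) j p) +
        E1 0 j * (de (Gs L 0) k p - Nc L 0 k p) + E1 1 j * (de (Gs L 1) k p - Nc L 1 k p) +
        E1 0 k * (de (Gs L 0) j p - Nc L 0 j p) + E1 1 k * (de (Gs L 1) j p - Nc L 1 j p)) +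
      (1 / 2) * (de (de L 0) j p * hG 0 k + de (de L 1) j p * hG 1 k +
        de (de L 0) k p * hG 0 j + de (de L 1) k p * hG 1 j) +
      (1 / 4) * (W1 + W2) -
      (1 / 4) * ((eta 0 p * de (Nc L 0 0) j p + eta 1 p * de (Nc L 0 1) j p + Nc L 0 j p) * S 0 k +
        (eta 0 p * de (Nc L 1 0) j p + eta 1 p * de (Nc L 1 1) j p + Nc L 1 j p) * S 1 k +
        (eta 0 p * de (Nc L 0 0) k p + eta 1 p * de (Nc L 0 1) k p + Nc L 0 k p) * S 0 j +
        (eta 0 p * de (Nc L 1 0) k p + eta 1 p * de (Nc L 1 1) k p + Nc L 1 k p) * S 1 j)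
  · have hw := fun l => hL.wedge_del_de_gm hB k j l hp
    have hv := fun s a => hL.wedge_de_gm hB s a p hp
    have d0 := hdiff 0
    have d1 := hdiff 1
    simp only [Fin.sum_univ_two] at d0 d1
    linear_combination (1 / 2) * (debar L 0 p * d1 - debar L 1 p * d0) +
      (1 / 2) * (
        eta 0 p * (hw 0 - hv 0 j * de (Nc L 0 0) k p - hv 1 j * de (Nc L 1 0) k p -
          hv 0 k * de (Nc L 0 0) j p - hv 1 k * de (Nc L 1 0) j p) +
        eta 1 p * (hw 1 - hv 0 j * de (Nc L 0 1) k p - hv 1 j * de (Nc L 1 1) k p -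
          hv 0 k * de (Nc L 0 1) j p - hv 1 k * de (Nc L 1 1) j p) +
        hv 0 j * (de (Gs L 0) k p - Nc L 0 k p) + hv 1 j * (de (Gs L 1) k p - Nc L 1 k p) +
        hv 0 k * (de (Gs L 0) j p - Nc L 0 j p) + hv 1 k * (de (Gs L 1) j p - Nc L 1 j p))

end CFinsler
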